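/- arXiv:2412.01138 — 3 statements merged into one kernel-verified Lean document; each statement's English description precedes it below -/
import Mathlib

section
/- Let F be a real normed space, let c_1, …, c_s ∈ [0,1] be distinct nodes, and let g : ℝ → F be s-times continuously differentiable on [0,1] with ‖g^{(s)}(θ)‖ ≤ M_s for all θ ∈ [0,1]. Then for every θ ∈ [0,1], the Lagrange interpolation error satisfies ‖g(θ) − ∑_{i=1}^s l_i(θ) g(c_i)‖ ≤ (M_s / s!) ∏_{i=1}^s |θ − c_i|. -/
/-- The `i`-th Lagrange basis polynomial `l_i(θ) = ∏_{m ≠ i} (θ - c_m)/(c_i - c_m)`. -/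
noncomputable def lagrangeBasis {s : ℕ} (c : Fin s → ℝ) (i : Fin s) (θ : ℝ) : ℝ :=
  ∏ m ∈ Finset.univ.erase i, (θ - c m) / (c i - c m)

open Polynomial in
lemma laux_poly_iteratedDeriv (P : ℝ[X]) (n : ℕ) :
    iteratedDeriv n (fun x => P.eval x) = fun x => (derivative^[n] P).eval x := by
  induction n with
  | zero => simp
  | succ n ih =>
    rw [iteratedDeriv_succ, ih, Function.iterate_succ_apply']
    ext x
    exact Polynomial.deriv _

open Polynomial in
lemma laux_monic_iterate (w : ℝ[X]) (n : ℕ) (hw : w.Monic) (hd : w.natDegree = n) :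
    derivative^[n] w = C (n.factorial : ℝ) := by
  have h1 : (derivative^[n] w).natDegree ≤ 0 := by
    have := natDegree_iterate_derivative w n
    omega
  rw [eq_C_of_natDegree_le_zero h1, coeff_iterate_derivative]
  have : w.coeff n = 1 := by rw [← hd]; exact hw
  simp [this, Nat.descFactorial_self]

/-- Generalized Rolle theorem. -/
lemma laux_rolle (n : ℕ) : ∀ (f : ℝ → ℝ), ContDiffOn ℝ n f (Set.Icc (0:ℝ) 1) →
    ∀ x : Fin (n + 1) → ℝ, StrictMono x → (∀ i, x i ∈ Set.Icc (0:ℝ) 1) → (∀ i, f (x i) = 0) →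
    ∃ ξ ∈ Set.Icc (0:ℝ) 1, iteratedDerivWithin n f (Set.Icc (0:ℝ) 1) ξ = 0 := by
  induction n with
  | zero =>
    intro f _ x _ hx h0
    exact ⟨x 0, hx 0, by simpa using h0 0⟩
  | succ n ih =>
    intro f hf x hmono hx h0
    have hU : UniqueDiffOn ℝ (Set.Icc (0:ℝ) 1) := uniqueDiffOn_Icc zero_lt_one
    have hf' : ContDiffOn ℝ n (derivWithin f (Set.Icc (0:ℝ) 1)) (Set.Icc (0:ℝ) 1) :=
      hf.derivWithin hU (by norm_cast)
    have key : ∀ i : Fin (n + 1), ∃ y ∈ Set.Ioo (x i.castSucc) (x i.succ),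
        derivWithin f (Set.Icc (0:ℝ) 1) y = 0 := by
      intro i
      have hlt : x i.castSucc < x i.succ := hmono Fin.castSucc_lt_succ
      have hsub : Set.Icc (x i.castSucc) (x i.succ) ⊆ Set.Icc (0:ℝ) 1 :=
        Set.Icc_subset_Icc (hx _).1 (hx _).2
      obtain ⟨y, hy, hy0⟩ := exists_deriv_eq_zero hlt (hf.continuousOn.mono hsub)
        ((h0 _).trans (h0 _).symm)
      refine ⟨y, hy, ?_⟩
      rw [derivWithin_of_mem_nhds, hy0]
      exact Icc_mem_nhds (lt_of_le_of_lt (hx _).1 hy.1) (lt_of_lt_of_le hy.2 (hx _).2)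
    choose y hy hy0 using key
    have hymono : StrictMono y := by
      rw [Fin.strictMono_iff_lt_succ]
      intro i
      have h1 := (hy i.castSucc).2
      have h2 := (hy i.succ).1
      rw [Fin.succ_castSucc] at h1
      exact h1.trans h2
    obtain ⟨ξ, hξ, hξ0⟩ := ih _ hf' y hymono
      (fun i => ⟨(hx _).1.trans (hy i).1.le, (hy i).2.le.trans (hx _).2⟩) hy0
    exact ⟨ξ, hξ, by rw [iteratedDerivWithin_succ']; exact hξ0⟩

lemma laux_basis {s : ℕ} (c : Fin s → ℝ) (i : Fin s) (θ : ℝ) :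
    lagrangeBasis c i θ = (Lagrange.basis Finset.univ c i).eval θ := by
  rw [lagrangeBasis, Lagrange.basis, Polynomial.eval_prod]
  refine Finset.prod_congr rfl fun m _ => ?_
  simp [Lagrange.basisDivisor, div_eq_inv_mul]

open Polynomial in
lemma laux_scalar {s : ℕ} (c : Fin s → ℝ)
    (hc_inj : Function.Injective c) (hc_mem : ∀ i, c i ∈ Set.Icc (0:ℝ) 1)
    (f : ℝ → ℝ) (hf : ContDiffOn ℝ s f (Set.Icc (0:ℝ) 1))
    (θ : ℝ) (hθ : θ ∈ Set.Icc (0:ℝ) 1) (hne : ∀ i, θ ≠ c i) :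
    ∃ ξ ∈ Set.Icc (0:ℝ) 1, f θ - ∑ i, lagrangeBasis c i θ * f (c i) =
      iteratedDerivWithin s f (Set.Icc (0:ℝ) 1) ξ / s.factorial * ∏ i, (θ - c i) := by
  have hU : UniqueDiffOn ℝ (Set.Icc (0:ℝ) 1) := uniqueDiffOn_Icc zero_lt_one
  set p : ℝ[X] := Lagrange.interpolate Finset.univ c (fun i => f (c i)) with hp
  set w : ℝ[X] := Lagrange.nodal Finset.univ c with hw
  have hpθ : ∑ i, lagrangeBasis c i θ * f (c i) = p.eval θ := by
    rw [hp, Lagrange.interpolate_apply, eval_finsetSum]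
    refine Finset.sum_congr rfl fun i _ => ?_
    rw [laux_basis, eval_mul, eval_C, mul_comm]
  have hwθ : w.eval θ = ∏ i, (θ - c i) := Lagrange.eval_nodal
  have hw0 : w.eval θ ≠ 0 := Lagrange.eval_nodal_not_at_node fun i _ => hne i
  set K : ℝ := (f θ - p.eval θ) / w.eval θ with hK
  set P : ℝ[X] := p + C K * w with hP
  have hPs : derivative^[s] P = C (K * s.factorial) := by
    rw [hP, iterate_map_add, iterate_derivative_C_mul,
      laux_monic_iterate w s Lagrange.nodal_monic (by simp [hw]),
      iterate_derivative_eq_zero_of_degree_lt, zero_add, C_mul]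
    simpa [hp] using Lagrange.degree_interpolate_lt (s := Finset.univ) (v := c)
      (fun i => f (c i)) hc_inj.injOn
  have hPc : ContDiff ℝ s (fun x => P.eval x) := by
    simpa using P.contDiff_aeval (𝕜 := ℝ) (R := ℝ) s
  set h : ℝ → ℝ := f - fun x => P.eval x with hh
  have hhc : ContDiffOn ℝ s h (Set.Icc (0:ℝ) 1) := hf.sub hPc.contDiffOn
  have hhθ : h θ = 0 := by
    simp only [hh, Pi.sub_apply, hP, eval_add, eval_mul, eval_C, hK]
    field_simp
    ring
  have hhc0 : ∀ i, h (c i) = 0 := by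
    intro i
    have h1 : p.eval (c i) = f (c i) :=
      Lagrange.eval_interpolate_at_node (fun i => f (c i)) hc_inj.injOn (Finset.mem_univ i)
    have h2 : w.eval (c i) = 0 := Lagrange.eval_nodal_at_node (Finset.mem_univ i)
    simp [hh, hP, h1, h2]
  set t : Finset ℝ := insert θ (Finset.univ.image c) with ht
  have hcard : t.card = s + 1 := by
    rw [ht, Finset.card_insert_of_notMem, Finset.card_image_of_injective _ hc_inj]
    · simp
    · simpa using fun i => (hne i).symm
  have htm : ∀ z ∈ t, z ∈ Set.Icc (0:ℝ) 1 ∧ h z = 0 := by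
    intro z hz
    rw [ht, Finset.mem_insert, Finset.mem_image] at hz
    rcases hz with rfl | ⟨i, _, rfl⟩
    · exact ⟨hθ, hhθ⟩
    · exact ⟨hc_mem i, hhc0 i⟩
  obtain ⟨ξ, hξ, hξ0⟩ := laux_rolle s h hhc (t.orderEmbOfFin hcard)
    (t.orderEmbOfFin hcard).strictMono
    (fun i => (htm _ (t.orderEmbOfFin_mem hcard i)).1)
    (fun i => (htm _ (t.orderEmbOfFin_mem hcard i)).2)
  refine ⟨ξ, hξ, ?_⟩
  rw [hh, iteratedDerivWithin_sub hξ hU (hf ξ hξ) hPc.contDiffAt.contDiffWithinAt,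
    iteratedDerivWithin_eq_iteratedDeriv hU hPc.contDiffAt hξ, laux_poly_iteratedDeriv, hPs,
    sub_eq_zero] at hξ0
  simp only [eval_C] at hξ0
  have hfac : (s.factorial : ℝ) ≠ 0 := by positivity
  rw [hξ0, hpθ, ← hwθ, mul_div_assoc, div_self hfac, mul_one, hK, div_mul_cancel₀ _ hw0]

/-- **Lagrange interpolation error bound in a normed space.** If `g : ℝ → F` is `s`-times
continuously differentiable on `[0,1]` with `‖g^{(s)}‖ ≤ M_s` there, and `c_1, …, c_s ∈ [0,1]`
are distinct nodes, then for every `θ ∈ [0,1]`,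
`‖g(θ) - ∑_i l_i(θ) g(c_i)‖ ≤ (M_s / s!) ∏_i |θ - c_i|`. -/
theorem lagrange_interpolation_error
    {F : Type*} [NormedAddCommGroup F] [NormedSpace ℝ F]
    {s : ℕ} (c : Fin s → ℝ)
    (hc_inj : Function.Injective c) (hc_mem : ∀ i, c i ∈ Set.Icc (0:ℝ) 1)
    (g : ℝ → F) (Ms : ℝ)
    (hg : ContDiffOn ℝ s g (Set.Icc (0:ℝ) 1))
    (hbound : ∀ θ ∈ Set.Icc (0:ℝ) 1,
      ‖iteratedDerivWithin s g (Set.Icc (0:ℝ) 1) θ‖ ≤ Ms)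
    (θ : ℝ) (hθ : θ ∈ Set.Icc (0:ℝ) 1) :
    ‖g θ - ∑ i, lagrangeBasis c i θ • g (c i)‖ ≤
      (Ms / s.factorial) * ∏ i, |θ - c i| := by
  by_cases hne : ∀ i, θ ≠ c i
  · obtain ⟨φ, hφ, hφE⟩ := exists_dual_vector'' ℝ (g θ - ∑ i, lagrangeBasis c i θ • g (c i))
    have hU : UniqueDiffOn ℝ (Set.Icc (0:ℝ) 1) := uniqueDiffOn_Icc zero_lt_one
    obtain ⟨ξ, hξ, hE⟩ := laux_scalar c hc_inj hc_mem (φ ∘ g)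
      (φ.contDiff.comp_contDiffOn hg) θ hθ hne
    have hd : iteratedDerivWithin s (φ ∘ g) (Set.Icc (0:ℝ) 1) ξ =
        φ (iteratedDerivWithin s g (Set.Icc (0:ℝ) 1) ξ) := by
      rw [iteratedDerivWithin_eq_iteratedFDerivWithin, iteratedDerivWithin_eq_iteratedFDerivWithin,
        φ.iteratedFDerivWithin_comp_left (hg ξ hξ) hU hξ le_rfl]
      rfl
    have hE' : ‖g θ - ∑ i, lagrangeBasis c i θ • g (c i)‖ =
        φ (iteratedDerivWithin s g (Set.Icc (0:ℝ) 1) ξ) / s.factorial * ∏ i, (θ - c i) := by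
      rw [← hd, ← hE]
      have := hφE.symm
      simpa using this
    have hb : |φ (iteratedDerivWithin s g (Set.Icc (0:ℝ) 1) ξ)| ≤ Ms :=
      calc _ ≤ 1 * ‖iteratedDerivWithin s g (Set.Icc (0:ℝ) 1) ξ‖ := φ.le_of_opNorm_le hφ _
        _ ≤ Ms := by rw [one_mul]; exact hbound ξ hξ
    rw [hE']
    refine (le_abs_self _).trans ?_
    rw [abs_mul, abs_div, Finset.abs_prod, Nat.abs_cast]
    gcongr
  · push Not at hne
    obtain ⟨j, rfl⟩ := hne
    have h1 : ∑ i, lagrangeBasis c i (c j) • g (c i) = g (c j) := by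
      rw [Finset.sum_eq_single j]
      · rw [laux_basis, Lagrange.eval_basis_self hc_inj.injOn (Finset.mem_univ j), one_smul]
      · intro i _ hij
        rw [laux_basis, Lagrange.eval_basis_of_ne hij (Finset.mem_univ j), zero_smul]
      · simp
    have h2 : ∏ i, |c j - c i| = 0 := Finset.prod_eq_zero (Finset.mem_univ j) (by simp)
    rw [h1, h2]
    simp
end

section
/- (Core recursion lemma of Theorem 4.3.) Let α ≥ 1 and β, γ, δ ≥ 0 be real numbers, and let e : ℕ × ℕ → ℝ be nonnegative with e(0, k) = 0 for all k, e(n, 0) ≤ α e(n−1, 0) + δ for all n ≥ 1, and e(n, k) ≤ α e(n−1, k) + β e(n−1, k−1) + γ for all n ≥ 1 and k ≥ 1. Then for all integers n ≥ 1 and k ≥ n, e(n, k) ≤ n (α + β)^{n−1} γ. -/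
/-- **Core recursion lemma of Theorem 4.3.** If the nonnegative double sequence `e`
satisfies `e 0 k = 0`, `e n 0 ≤ α e (n-1) 0 + δ` and
`e n k ≤ α e (n-1) k + β e (n-1) (k-1) + γ` (for `n, k ≥ 1`), with `α ≥ 1` and
`β, γ, δ ≥ 0`, then `e n k ≤ n (α + β)^{n-1} γ` whenever `1 ≤ n ≤ k`. -/
theorem parareal_recursion_bound
    (α β γ δ : ℝ) (hα : 1 ≤ α) (hβ : 0 ≤ β) (hγ : 0 ≤ γ) (hδ : 0 ≤ δ)
    (e : ℕ → ℕ → ℝ)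
    (he_nonneg : ∀ n k, 0 ≤ e n k)
    (he_zero : ∀ k, e 0 k = 0)
    (he_init : ∀ n, 1 ≤ n → e n 0 ≤ α * e (n - 1) 0 + δ)
    (he_rec : ∀ n k, 1 ≤ n → 1 ≤ k →
      e n k ≤ α * e (n - 1) k + β * e (n - 1) (k - 1) + γ) :
    ∀ n k : ℕ, 1 ≤ n → n ≤ k → e n k ≤ n * (α + β) ^ (n - 1) * γ := by
  intro n k hn
  induction n, hn using Nat.le_induction generalizing k with
  | base =>
    intro hk
    have h := he_rec 1 k le_rfl hk
    simp [he_zero] at h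
    simpa using h
  | succ n hn ih =>
    intro hk
    have h := he_rec (n + 1) k (by omega) (by omega)
    simp only [Nat.add_sub_cancel] at h ⊢
    have h1 := mul_le_mul_of_nonneg_left (ih k (by omega)) (by linarith : 0 ≤ α)
    have h2 := mul_le_mul_of_nonneg_left (ih (k - 1) (by omega)) hβ
    have hp : (1 : ℝ) ≤ (α + β) ^ n := one_le_pow₀ (by linarith)
    have h3 := mul_le_mul_of_nonneg_right hp hγ
    have h4 : (α + β) ^ n = (α + β) ^ (n - 1) * (α + β) := by
      rw [← pow_succ, Nat.sub_add_cancel hn]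
    have h5 : ((n + 1 : ℕ) : ℝ) * (α + β) ^ n * γ
        = α * (n * (α + β) ^ (n - 1) * γ) + β * (n * (α + β) ^ (n - 1) * γ)
          + (α + β) ^ n * γ := by
      rw [h4]; push_cast; ring
    linarith
end

section
/- (Abstract form of Theorem 4.3: convergence of the Parareal iteration.) Let E be a real normed space, and let α ≥ 1, β ≥ 0, γ ≥ 0, δ ≥ 0. For n = 0, …, N−1 let G_n, F_n, H_n : E → E be maps such that for all v, w, ξ ∈ E: (i) ‖F_n(v) − H_n(v)‖ ≤ γ; (ii) ‖G_n(v) − H_n(v)‖ ≤ δ; (iii) ‖G_n(v) − G_n(w)‖ ≤ α ‖v − w‖; (iv) ‖G_n(v) − G_n(w) + H_n(w) − H_n(ξ)‖ ≤ α ‖v − ξ‖ + β ‖w − ξ‖. Let u_0 = U^0 ∈ E and u_{n+1} = H_n(u_n). Then the Parareal iterates satisfy, for all integers 1 ≤ n ≤ N and k ≥ n, ‖U^{n,(k)} − u_n‖ ≤ n (α + β)^{n−1} γ; i.e., after finitely many iterations the Parareal approximation attains the accuracy γ of the fine propagator up to the stability factor n(α+β)^{n−1}. -/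
/-- **Abstract form of Theorem 4.3: convergence of the Parareal iteration.**
Under the fine-propagator accuracy `γ`, coarse-propagator accuracy `δ`, Lipschitz
stability of the coarse propagator and the mixed Lipschitz condition, the Parareal
iterates satisfy `‖U^{n,(k)} - u_n‖ ≤ n (α + β)^{n-1} γ` for all `1 ≤ n ≤ N`, `k ≥ n`. -/
theorem parareal_convergence
    {E : Type*} [NormedAddCommGroup E] [NormedSpace ℝ E]
    (N : ℕ) (α β γ δ : ℝ) (hα : 1 ≤ α) (hβ : 0 ≤ β) (hγ : 0 ≤ γ) (hδ : 0 ≤ δ)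
    (G F H : ℕ → E → E)
    (hFH : ∀ n < N, ∀ v : E, ‖F n v - H n v‖ ≤ γ)
    (hGH : ∀ n < N, ∀ v : E, ‖G n v - H n v‖ ≤ δ)
    (hG_lip : ∀ n < N, ∀ v w : E, ‖G n v - G n w‖ ≤ α * ‖v - w‖)
    (hmix : ∀ n < N, ∀ v w ξ : E,
      ‖G n v - G n w + H n w - H n ξ‖ ≤ α * ‖v - ξ‖ + β * ‖w - ξ‖)
    (U₀ : E) (u : ℕ → E) (hu0 : u 0 = U₀) (hu : ∀ n < N, u (n + 1) = H n (u n))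
    (U : ℕ → ℕ → E)
    (hU0 : ∀ k, U 0 k = U₀)
    (hUinit : ∀ n < N, U (n + 1) 0 = G n (U n 0))
    (hUrec : ∀ n < N, ∀ k : ℕ,
      U (n + 1) (k + 1) = G n (U n (k + 1)) + F n (U n k) - G n (U n k)) :
    ∀ n k : ℕ, 1 ≤ n → n ≤ N → n ≤ k →
      ‖U n k - u n‖ ≤ n * (α + β) ^ (n - 1) * γ := by
  have key : ∀ n : ℕ, n ≤ N → ∀ k, n ≤ k →
      ‖U n k - u n‖ ≤ n * (α + β) ^ (n - 1) * γ := by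
    intro n
    induction n with
    | zero =>
      intro _ k _
      simp [hU0, hu0]
    | succ n ih =>
      intro hn k hk
      obtain ⟨m, rfl⟩ : ∃ m, k = m + 1 := ⟨k - 1, by omega⟩
      have hnN : n < N := by omega
      have h1 := ih (by omega) (m + 1) (by omega)
      have h2 := ih (by omega) m (by omega)
      have hm := hmix n hnN (U n (m + 1)) (U n m) (u n)
      have hf := hFH n hnN (U n m)
      have heq : U (n + 1) (m + 1) - u (n + 1)
          = (G n (U n (m + 1)) - G n (U n m) + H n (U n m) - H n (u n))
            + (F n (U n m) - H n (U n m)) := by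
        rw [hUrec n hnN, hu n hnN]
        abel
      have hB : (α + β) * (n * (α + β) ^ (n - 1) * γ) = n * (α + β) ^ n * γ := by
        cases n with
        | zero => simp
        | succ j =>
          simp only [Nat.add_sub_cancel]
          ring
      have hp : γ ≤ (α + β) ^ n * γ :=
        le_mul_of_one_le_left hγ (one_le_pow₀ (by linarith))
      have ha := mul_le_mul_of_nonneg_left h1 (by linarith : (0 : ℝ) ≤ α)
      have hb := mul_le_mul_of_nonneg_left h2 hβ
      have ht := norm_add_le
        (G n (U n (m + 1)) - G n (U n m) + H n (U n m) - H n (u n))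
        (F n (U n m) - H n (U n m))
      rw [heq, Nat.add_sub_cancel]
      push_cast
      linarith
  intro n k _ hn hk
  exact key n hn k hk
end
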